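/- Let N > 4, let u ∈ W^{2,2}_loc(ℝ^N) ∩ L^∞_loc(ℝ^N) with u ≥ 0 and Δu ≥ 0 a.e. in ℝ^N, and let γ > 2. Then u^γ ∈ W^{2,2}_loc(ℝ^N), u^γ ≥ 0 a.e., and Δ(u^γ) ≥ 0 a.e. in ℝ^N. -/

import Mathlib

open MeasureTheory Filter

/-- The `i`-th partial derivative of `f` at `x`. -/
noncomputable def pd (N : ℕ) (i : Fin N) (f : EuclideanSpace ℝ (Fin N) → ℝ)
    (x : EuclideanSpace ℝ (Fin N)) : ℝ :=
  fderiv ℝ f x (EuclideanSpace.single i 1)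

/-- `w` is the `i`-th weak partial derivative of `u`. -/
def IsWeakPd (N : ℕ) (i : Fin N) (u w : EuclideanSpace ℝ (Fin N) → ℝ) : Prop :=
  ∀ φ : EuclideanSpace ℝ (Fin N) → ℝ, ContDiff ℝ (⊤ : ℕ∞) φ → HasCompactSupport φ →
    ∫ x, u x * pd N i φ x = - ∫ x, w x * φ x

/-- The Laplacian extracted from (the trace of) a Hessian `h`. -/
noncomputable def wlap (N : ℕ) (h : EuclideanSpace ℝ (Fin N) → Fin N → Fin N → ℝ)
    (x : EuclideanSpace ℝ (Fin N)) : ℝ :=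
  ∑ i : Fin N, h x i i

/-- `u ∈ W^{2,2}_loc(ℝ^N)`, with weak gradient `g` and weak Hessian `h`. -/
structure W22loc (N : ℕ) (u : EuclideanSpace ℝ (Fin N) → ℝ)
    (g : EuclideanSpace ℝ (Fin N) → Fin N → ℝ)
    (h : EuclideanSpace ℝ (Fin N) → Fin N → Fin N → ℝ) : Prop where
  grad_spec : ∀ i : Fin N, IsWeakPd N i u (fun x => g x i)
  hess_spec : ∀ i j : Fin N, IsWeakPd N j (fun x => g x i) (fun x => h x i j)
  u_sq : ∀ K : Set (EuclideanSpace ℝ (Fin N)), IsCompact K →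
    IntegrableOn (fun x => (u x) ^ 2) K
  g_sq : ∀ i : Fin N, ∀ K : Set (EuclideanSpace ℝ (Fin N)), IsCompact K →
    IntegrableOn (fun x => (g x i) ^ 2) K
  h_sq : ∀ i j : Fin N, ∀ K : Set (EuclideanSpace ℝ (Fin N)), IsCompact K →
    IntegrableOn (fun x => (h x i j) ^ 2) K

/-- `u ∈ L^∞_loc(ℝ^N)`. -/
def LinftyLoc (N : ℕ) (u : EuclideanSpace ℝ (Fin N) → ℝ) : Prop :=
  ∀ K : Set (EuclideanSpace ℝ (Fin N)), IsCompact K →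
    ∃ C : ℝ, ∀ᵐ x ∂(volume : Measure (EuclideanSpace ℝ (Fin N))), x ∈ K → |u x| ≤ C

open scoped ContDiff Topology

lemma contDiff_pd {N : ℕ} (i : Fin N) {φ : EuclideanSpace ℝ (Fin N) → ℝ} (hφ : ContDiff ℝ ∞ φ) :
    ContDiff ℝ ∞ (pd N i φ) :=
  (hφ.fderiv_right (m := ∞) (by simp)).clm_apply contDiff_const

lemma hasCompactSupport_pd {N : ℕ} (i : Fin N) {φ : EuclideanSpace ℝ (Fin N) → ℝ}
    (hφ : HasCompactSupport φ) : HasCompactSupport (pd N i φ) :=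
  (hφ.fderiv ℝ).mono fun x hx => by
    contrapose! hx
    simp_all [pd]

/-- A sequence of bump functions on `ℝ^N` whose supports shrink to the origin. -/
noncomputable def shrinkingBump (N n : ℕ) : ContDiffBump (0 : EuclideanSpace ℝ (Fin N)) where
  rIn := 1 / (n + 2)
  rOut := 2 / (n + 2)
  rIn_pos := by positivity
  rIn_lt_rOut := by gcongr; norm_num

/-- The mollification of `f` by the `n`-th shrinking bump function. -/
noncomputable def moll {N : ℕ} (n : ℕ) (f : EuclideanSpace ℝ (Fin N) → ℝ)
    (x : EuclideanSpace ℝ (Fin N)) : ℝ :=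
  ∫ t, f t * (shrinkingBump N n).normed volume (x - t)

section Mollification

variable {N : ℕ} {f u w : EuclideanSpace ℝ (Fin N) → ℝ}

lemma moll_eq_convolution (n : ℕ) :
    moll n f = convolution f ((shrinkingBump N n).normed volume)
      (ContinuousLinearMap.lsmul ℝ ℝ) volume := rfl

lemma moll_eq_convolution_swap (n : ℕ) :
    moll n f = convolution ((shrinkingBump N n).normed volume) f
      (ContinuousLinearMap.lsmul ℝ ℝ) volume := by
  ext x
  rw [convolution_lsmul_swap]
  simp [moll, mul_comm]

lemma rOut_shrinkingBump_le (n : ℕ) : (shrinkingBump N n).rOut ≤ 1 := by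
  change (2 : ℝ) / (n + 2) ≤ 1
  rw [div_le_one (by positivity)]
  linarith [(Nat.cast_nonneg n : (0 : ℝ) ≤ n)]

lemma tendsto_moll_ae (hf : LocallyIntegrable f volume) :
    ∀ᵐ x ∂(volume : Measure (EuclideanSpace ℝ (Fin N))),
      Tendsto (fun n => moll n f x) atTop (𝓝 (f x)) := by
  simp only [moll_eq_convolution_swap]
  refine ContDiffBump.ae_convolution_tendsto_right_of_locallyIntegrable (K := 2) ?_ ?_ hf
  · change Tendsto (fun n : ℕ => (2 : ℝ) / (n + 2)) atTop (𝓝 0)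
    exact tendsto_const_nhds.div_atTop
      (tendsto_atTop_add_const_right _ _ tendsto_natCast_atTop_atTop)
  · refine Eventually.of_forall fun n => ?_
    change (2 : ℝ) / (n + 2) ≤ 2 * (1 / (n + 2))
    rw [mul_one_div]

lemma contDiff_moll (n : ℕ) (hf : LocallyIntegrable f volume) : ContDiff ℝ ∞ (moll n f) := by
  rw [moll_eq_convolution_swap]
  exact (shrinkingBump N n).hasCompactSupport_normed.contDiff_convolution_left _
    (shrinkingBump N n).contDiff_normed hf

lemma pd_moll (n : ℕ) {i : Fin N} (hu : LocallyIntegrable u volume) (h : IsWeakPd N i u w) :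
    pd N i (moll n u) = moll n w := by
  ext x
  set ρ := (shrinkingBump N n).normed (volume : Measure (EuclideanSpace ℝ (Fin N))) with hρ
  have hρc : HasCompactSupport ρ := (shrinkingBump N n).hasCompactSupport_normed
  have hρs : ContDiff ℝ ∞ ρ := (shrinkingBump N n).contDiff_normed
  have hρs1 : ContDiff ℝ 1 ρ := (shrinkingBump N n).contDiff_normed
  have hd := hρc.hasFDerivAt_convolution_right (ContinuousLinearMap.lsmul ℝ ℝ) hu hρs1 x
  have h1 : pd N i (moll n u) x = ∫ t, u t * pd N i ρ (x - t) := by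
    rw [pd, moll_eq_convolution, hd.fderiv, convolution_precompR_apply _ hu (hρc.fderiv ℝ)
      (hρs1.continuous_fderiv one_ne_zero)]
    rfl
  have hsub : ContDiff ℝ ∞ (fun t => ρ (x - t)) := hρs.comp (contDiff_const.sub contDiff_id)
  have hsubc : HasCompactSupport (fun t => ρ (x - t)) :=
    hρc.comp_homeomorph (Homeomorph.subLeft x)
  have h2 : ∀ t, pd N i (fun t => ρ (x - t)) t = - pd N i ρ (x - t) := by
    intro t
    have hdt : HasFDerivAt ρ (fderiv ℝ ρ (x - t)) (x - t) :=
      (hρs1.differentiable one_ne_zero _).hasFDerivAt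
    have := hdt.comp t ((hasFDerivAt_id t).const_sub x)
    have h3 := this.fderiv
    simp only [Function.comp_def] at h3
    rw [pd, h3]
    simp [pd]
  have h3 := h _ hsub hsubc
  simp only [h2, mul_neg, integral_neg, neg_inj] at h3
  rw [h1, h3]
  rfl

lemma integrable_normed_sub (n : ℕ) (x : EuclideanSpace ℝ (Fin N)) :
    Integrable (fun t => (shrinkingBump N n).normed volume (x - t)) :=
  (shrinkingBump N n).integrable_normed.comp_sub_left x

lemma integral_normed_sub (n : ℕ) (x : EuclideanSpace ℝ (Fin N)) :
    ∫ t, (shrinkingBump N n).normed volume (x - t) = 1 := by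
  rw [integral_sub_left_eq_self (fun t => (shrinkingBump N n).normed volume t) volume x,
    ContDiffBump.integral_normed]

lemma normed_sub_eq_zero (n : ℕ) {x t : EuclideanSpace ℝ (Fin N)} (h : 1 ≤ dist t x) :
    (shrinkingBump N n).normed volume (x - t) = 0 := by
  refine Function.notMem_support.1 ?_
  rw [ContDiffBump.support_normed_eq, Metric.mem_ball, dist_zero_right, ← dist_eq_norm, dist_comm]
  linarith [rOut_shrinkingBump_le (N := N) n]

lemma abs_moll_le (n : ℕ) {M : ℝ} {x : EuclideanSpace ℝ (Fin N)}
    (h : ∀ᵐ t ∂(volume : Measure (EuclideanSpace ℝ (Fin N))),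
      t ∈ Metric.closedBall x 1 → |f t| ≤ M) : |moll n f x| ≤ M := by
  have : ‖moll n f x‖ ≤ ∫ t, M * (shrinkingBump N n).normed volume (x - t) := by
    refine norm_integral_le_of_norm_le ((integrable_normed_sub n x).const_mul M) ?_
    filter_upwards [h] with t ht
    rw [norm_mul, Real.norm_eq_abs, Real.norm_of_nonneg ((shrinkingBump N n).nonneg_normed _)]
    by_cases hx : t ∈ Metric.closedBall x 1
    · exact mul_le_mul_of_nonneg_right (ht hx) ((shrinkingBump N n).nonneg_normed _)
    · rw [normed_sub_eq_zero n (by simpa using (not_le.1 hx).le)]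
      simp
  simpa [integral_const_mul, integral_normed_sub] using this

lemma moll_nonneg (n : ℕ) (x : EuclideanSpace ℝ (Fin N))
    (h : ∀ᵐ t ∂(volume : Measure (EuclideanSpace ℝ (Fin N))), 0 ≤ f t) : 0 ≤ moll n f x := by
  refine integral_nonneg_of_ae ?_
  filter_upwards [h] with t ht
  exact mul_nonneg ht ((shrinkingBump N n).nonneg_normed _)

lemma integrable_moll (n : ℕ) (hf : Integrable f) : Integrable (moll n f) :=
  hf.integrable_convolution (ContinuousLinearMap.lsmul ℝ ℝ) (shrinkingBump N n).integrable_normed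

lemma integrable_moll_sub (n : ℕ) (hf : Integrable f) : Integrable (fun x => moll n f x - f x) :=
  (integrable_moll n hf).sub hf

lemma integral_moll (n : ℕ) (hf : Integrable f) : ∫ x, moll n f x = ∫ x, f x := by
  rw [moll_eq_convolution, integral_convolution _ hf (shrinkingBump N n).integrable_normed,
    ContDiffBump.integral_normed]
  simp

lemma integrable_mul_normed_sub (n : ℕ) (x : EuclideanSpace ℝ (Fin N))
    (hf : LocallyIntegrable f) :
    Integrable (fun t => f t * (shrinkingBump N n).normed volume (x - t)) := by
  have hc : HasCompactSupport (fun t => (shrinkingBump N n).normed volume (x - t)) :=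
    (shrinkingBump N n).hasCompactSupport_normed.comp_homeomorph (Homeomorph.subLeft x)
  have := hf.integrable_smul_right_of_hasCompactSupport
    (((shrinkingBump N n).continuous_normed (μ := volume)).comp
      (continuous_const.sub continuous_id)) hc
  simpa using this

/-- Scheffé's lemma for mollifications of nonnegative functions. -/
lemma tendsto_integral_abs_moll_sub_of_nonneg (hf : Integrable f) (h0 : ∀ x, 0 ≤ f x) :
    Tendsto (fun n => ∫ x, |moll n f x - f x|) atTop (𝓝 0) := by
  have hpos : Tendsto (fun n => ∫ x, max (f x - moll n f x) 0) atTop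
      (𝓝 (∫ _ : EuclideanSpace ℝ (Fin N), (0 : ℝ))) := by
    refine tendsto_integral_of_dominated_convergence f
      (fun n => ((hf.sub (integrable_moll n hf)).pos_part).aestronglyMeasurable) hf ?_ ?_
    · refine fun n => Eventually.of_forall fun x => ?_
      have := moll_nonneg n x (Eventually.of_forall h0)
      rw [Real.norm_of_nonneg (le_max_right _ _)]
      exact max_le (by linarith) (h0 x)
    · filter_upwards [tendsto_moll_ae hf.locallyIntegrable] with x hx
      have := ((tendsto_const_nhds (x := f x)).sub hx).max (tendsto_const_nhds (x := (0 : ℝ)))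
      simpa using this
  have heq : ∀ n, ∫ x, |moll n f x - f x| = 2 * ∫ x, max (f x - moll n f x) 0 := by
    intro n
    have h1 : ∀ x, |moll n f x - f x|
        = 2 * max (f x - moll n f x) 0 - (f x - moll n f x) := by
      intro x
      rcases le_total (f x - moll n f x) 0 with h | h
      · rw [max_eq_right h, abs_of_nonneg (by linarith)]; ring
      · rw [max_eq_left h, abs_of_nonpos (by linarith)]; ring
    have hsub : Integrable (fun x => f x - moll n f x) := hf.sub (integrable_moll n hf)
    simp_rw [h1]
    rw [integral_sub (hsub.pos_part.const_mul 2) hsub, integral_const_mul,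
      integral_sub hf (integrable_moll n hf), integral_moll n hf]
    ring
  simp_rw [heq]
  simpa using hpos.const_mul 2

lemma tendsto_integral_abs_moll_sub (hf : Integrable f) :
    Tendsto (fun n => ∫ x, |moll n f x - f x|) atTop (𝓝 0) := by
  have hp := hf.pos_part
  have hn := hf.neg_part
  have h := (tendsto_integral_abs_moll_sub_of_nonneg hp fun x => le_max_right _ _).add
    (tendsto_integral_abs_moll_sub_of_nonneg hn fun x => le_max_right _ _)
  rw [add_zero] at h
  have hdec : ∀ x, f x = max (f x) 0 - max (-f x) 0 := fun x => by
    rcases le_total (f x) 0 with h | h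
    · rw [max_eq_right h, max_eq_left (by linarith)]; ring
    · rw [max_eq_left h, max_eq_right (by linarith)]; ring
  refine squeeze_zero (fun n => integral_nonneg fun x => abs_nonneg _) (fun n => ?_) h
  rw [← integral_add (integrable_moll_sub n hp).abs (integrable_moll_sub n hn).abs]
  refine integral_mono (integrable_moll_sub n hf).abs
    ((integrable_moll_sub n hp).abs.add (integrable_moll_sub n hn).abs) fun x => ?_
  have hm : moll n f x = moll n (fun x => max (f x) 0) x - moll n (fun x => max (-f x) 0) x := by
    rw [moll, moll, moll, ← integral_sub (integrable_mul_normed_sub n x hp.locallyIntegrable)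
      (integrable_mul_normed_sub n x hn.locallyIntegrable)]
    refine integral_congr_ae (Eventually.of_forall fun t => ?_)
    simp only
    rw [← sub_mul, ← hdec]
  beta_reduce
  rw [hm, hdec x, show ∀ a b c d : ℝ, a - b - (c - d) = (a - c) - (b - d) by intros; ring]
  rw [← hdec x]
  exact abs_sub _ _

lemma tendsto_setIntegral_abs_moll_sub (hf : LocallyIntegrable f) (R : ℝ) :
    Tendsto (fun n => ∫ x in Metric.closedBall 0 R, |moll n f x - f x|) atTop (𝓝 0) := by
  set B := Metric.closedBall (0 : EuclideanSpace ℝ (Fin N)) (R + 1) with hB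
  have hBm : MeasurableSet B := measurableSet_closedBall
  have hi : Integrable (B.indicator f) :=
    (integrable_indicator_iff hBm).2 (hf.integrableOn_isCompact (isCompact_closedBall _ _))
  refine squeeze_zero (fun n => integral_nonneg fun x => abs_nonneg _) (fun n => ?_)
    (tendsto_integral_abs_moll_sub hi)
  refine le_trans (le_of_eq ?_) (setIntegral_le_integral (s := Metric.closedBall 0 R)
    (integrable_moll_sub n hi).abs (Eventually.of_forall fun x => abs_nonneg _))
  refine setIntegral_congr_fun measurableSet_closedBall fun x hx => ?_
  have hxR : dist x 0 ≤ R := hx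
  have h1 : B.indicator f x = f x := Set.indicator_of_mem (by
    rw [hB, Metric.mem_closedBall]; linarith) f
  have h2 : moll n (B.indicator f) x = moll n f x := by
    refine integral_congr_ae (Eventually.of_forall fun t => ?_)
    simp only
    by_cases ht : t ∈ B
    · rw [Set.indicator_of_mem ht]
    · rw [normed_sub_eq_zero n, mul_zero, mul_zero]
      rw [hB, Metric.mem_closedBall, not_le] at ht
      linarith [dist_triangle t x 0]
  rw [h1, h2]

lemma tendsto_integral_mul_moll {b : ℕ → EuclideanSpace ℝ (Fin N) → ℝ}
    {b' : EuclideanSpace ℝ (Fin N) → ℝ} {C R : ℝ} (hw : LocallyIntegrable w)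
    (hbm : ∀ n, AEStronglyMeasurable (b n) volume) (hbC : ∀ n x, |b n x| ≤ C)
    (hbR : ∀ n x, x ∉ Metric.closedBall 0 R → b n x = 0)
    (hlim : ∀ᵐ x ∂(volume : Measure (EuclideanSpace ℝ (Fin N))),
      Tendsto (fun n => b n x) atTop (𝓝 (b' x))) :
    Tendsto (fun n => ∫ x, b n x * moll n w x) atTop (𝓝 (∫ x, b' x * w x)) := by
  set B := Metric.closedBall (0 : EuclideanSpace ℝ (Fin N)) R with hB
  have hBm : MeasurableSet B := measurableSet_closedBall
  have hC : 0 ≤ C := (abs_nonneg _).trans (hbC 0 0)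
  have hwB : IntegrableOn w B := hw.integrableOn_isCompact (isCompact_closedBall _ _)
  have hmB : ∀ n, IntegrableOn (moll n w) B := fun n =>
    (contDiff_moll n hw).continuous.locallyIntegrable.integrableOn_isCompact
      (isCompact_closedBall _ _)
  have hbw : ∀ n, IntegrableOn (fun x => b n x * w x) B := fun n =>
    Integrable.bdd_mul hwB (hbm n).restrict (Eventually.of_forall (hbC n))
  have hbmw : ∀ n, IntegrableOn (fun x => b n x * moll n w x) B := fun n =>
    Integrable.bdd_mul (hmB n) (hbm n).restrict (Eventually.of_forall (hbC n))
  have h1 : Tendsto (fun n => ∫ x in B, b n x * w x) atTop (𝓝 (∫ x in B, b' x * w x)) := by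
    refine tendsto_integral_of_dominated_convergence (fun x => C * ‖w x‖)
      (fun n => (hbw n).aestronglyMeasurable) (hwB.norm.const_mul C) ?_ ?_
    · refine fun n => Eventually.of_forall fun x => ?_
      rw [norm_mul]
      exact mul_le_mul_of_nonneg_right (hbC n x) (norm_nonneg _)
    · filter_upwards [ae_restrict_of_ae hlim] with x hx using hx.mul_const _
  have h2 : Tendsto (fun n => ∫ x in B, b n x * (moll n w x - w x)) atTop (𝓝 0) := by
    refine squeeze_zero_norm (fun n => ?_)
      (by simpa using (tendsto_setIntegral_abs_moll_sub hw R).const_mul C)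
    rw [← integral_const_mul]
    refine norm_integral_le_of_norm_le (((hmB n).sub hwB).abs.const_mul C)
      (Eventually.of_forall fun x => ?_)
    rw [norm_mul]
    exact mul_le_mul_of_nonneg_right (hbC n x) (abs_nonneg _)
  have h3 := h1.add h2
  rw [add_zero] at h3
  have hset : ∀ n, ∫ x, b n x * moll n w x
      = (∫ x in B, b n x * w x) + ∫ x in B, b n x * (moll n w x - w x) := by
    intro n
    rw [← setIntegral_eq_integral_of_forall_compl_eq_zero (s := B) fun x hx => by
      rw [hbR n x hx, zero_mul]]
    simp_rw [mul_sub]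
    rw [integral_sub (hbmw n) (hbw n)]
    ring
  have hset' : ∫ x, b' x * w x = ∫ x in B, b' x * w x := by
    rw [← integral_indicator hBm]
    refine integral_congr_ae ?_
    filter_upwards [hlim] with x hx
    by_cases hxB : x ∈ B
    · rw [Set.indicator_of_mem hxB]
    · rw [Set.indicator_of_notMem hxB]
      have : b' x = 0 := tendsto_nhds_unique hx (by simp [hbR _ x hxB])
      simp [this]
  simp_rw [hset, hset']
  exact h3

end Mollification

section ChainRule

variable {N : ℕ}

lemma integrable_mul_of_tendsto_of_bounded {b : ℕ → EuclideanSpace ℝ (Fin N) → ℝ}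
    {b' w : EuclideanSpace ℝ (Fin N) → ℝ} {C R : ℝ} (hw : LocallyIntegrable w)
    (hbm : ∀ n, AEStronglyMeasurable (b n) volume) (hbC : ∀ n x, |b n x| ≤ C)
    (hbR : ∀ n x, x ∉ Metric.closedBall 0 R → b n x = 0)
    (hlim : ∀ᵐ x ∂(volume : Measure (EuclideanSpace ℝ (Fin N))),
      Tendsto (fun n => b n x) atTop (𝓝 (b' x))) :
    Integrable (fun x => b' x * w x) := by
  set B := Metric.closedBall (0 : EuclideanSpace ℝ (Fin N)) R with hB
  have hwB : Integrable (B.indicator w) :=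
    (integrable_indicator_iff measurableSet_closedBall).2
      (hw.integrableOn_isCompact (isCompact_closedBall _ _))
  have h : Integrable (fun x => b' x * B.indicator w x) := by
    refine Integrable.bdd_mul (c := C) hwB (aestronglyMeasurable_of_tendsto_ae atTop hbm hlim) ?_
    filter_upwards [hlim] with x hx
    exact le_of_tendsto hx.norm (Eventually.of_forall fun n => hbC n x)
  refine h.congr ?_
  filter_upwards [hlim] with x hx
  by_cases hxB : x ∈ B
  · rw [Set.indicator_of_mem hxB]
  · have : b' x = 0 := tendsto_nhds_unique hx (by simp [hbR _ x hxB])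
    simp [this]

lemma exists_closedBall_bound {φ : EuclideanSpace ℝ (Fin N) → ℝ} (hφ : Continuous φ)
    (hφc : HasCompactSupport φ) :
    ∃ R C : ℝ, (∀ x, x ∉ Metric.closedBall 0 R → φ x = 0) ∧ ∀ x, |φ x| ≤ C := by
  obtain ⟨R, hR⟩ := hφc.isCompact.isBounded.subset_closedBall 0
  obtain ⟨C, hC⟩ := hφc.exists_bound_of_continuous hφ
  exact ⟨R, C, fun x hx => image_eq_zero_of_notMem_tsupport fun h => hx (hR h), hC⟩

lemma moll_one (n : ℕ) (x : EuclideanSpace ℝ (Fin N)) : moll n (fun _ => 1) x = 1 := by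
  simp [moll, integral_normed_sub]

/-- Chain and product rule for weak derivatives: `P ∘ u` with `u` locally bounded and `P` of class
`C¹`, times `Q ∘ v` with `Q` of class `C¹`, bounded, and with bounded derivative. -/
lemma IsWeakPd.comp_mul_comp {i : Fin N} {u w v z : EuclideanSpace ℝ (Fin N) → ℝ}
    {P P' Q Q' : ℝ → ℝ} {C : ℝ} (hu : LocallyIntegrable u) (hub : LinftyLoc N u)
    (hw : LocallyIntegrable w) (hv : LocallyIntegrable v) (hz : LocallyIntegrable z)
    (huw : IsWeakPd N i u w) (hvz : IsWeakPd N i v z)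
    (hP : ∀ a, HasDerivAt P (P' a) a) (hP' : Continuous P')
    (hQ : ∀ a, HasDerivAt Q (Q' a) a) (hQ' : Continuous Q')
    (hQC : ∀ a, |Q a| ≤ C) (hQC' : ∀ a, |Q' a| ≤ C) :
    IsWeakPd N i (fun x => P (u x) * Q (v x))
      (fun x => P' (u x) * Q (v x) * w x + P (u x) * Q' (v x) * z x) := by
  intro φ hφ hφc
  have hPc : Continuous P := continuous_iff_continuousAt.2 fun a => (hP a).continuousAt
  have hQc : Continuous Q := continuous_iff_continuousAt.2 fun a => (hQ a).continuousAt
  have hC : 0 ≤ C := (abs_nonneg _).trans (hQC 0)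
  have hdφ := contDiff_pd i hφ
  have hdφc := hasCompactSupport_pd i hφc
  obtain ⟨R₁, D₁, hR₁, hD₁⟩ := exists_closedBall_bound hφ.continuous hφc
  obtain ⟨R₂, D₂, hR₂, hD₂⟩ := exists_closedBall_bound hdφ.continuous hdφc
  set R := max R₁ R₂
  set D := max D₁ D₂
  have hD : 0 ≤ D := (abs_nonneg _).trans ((hD₁ 0).trans (le_max_left _ _))
  obtain ⟨M, hM⟩ := hub (Metric.closedBall 0 (R + 1)) (isCompact_closedBall _ _)
  obtain ⟨A, hA⟩ := (isCompact_Icc (a := -M) (b := M)).exists_bound_of_continuousOn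
    hPc.continuousOn
  obtain ⟨A', hA'⟩ := (isCompact_Icc (a := -M) (b := M)).exists_bound_of_continuousOn
    hP'.continuousOn
  set L := max (max A A') 0
  have hL : 0 ≤ L := le_max_right _ _
  have hUM : ∀ n, ∀ x ∈ Metric.closedBall (0 : EuclideanSpace ℝ (Fin N)) R,
      moll n u x ∈ Set.Icc (-M) M := by
    intro n x hx
    refine abs_le.1 (abs_moll_le n ?_)
    filter_upwards [hM] with t ht htx
    refine ht ?_
    rw [Metric.mem_closedBall] at *
    linarith [dist_triangle t x 0]
  have hUc : ∀ n, Continuous (moll n u) := fun n => (contDiff_moll n hu).continuous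
  have hVc : ∀ n, Continuous (moll n v) := fun n => (contDiff_moll n hv).continuous
  have key : ∀ {p q : ℝ → ℝ} {ψ f : EuclideanSpace ℝ (Fin N) → ℝ}, Continuous p → Continuous q →
      Continuous ψ → (∀ a ∈ Set.Icc (-M) M, |p a| ≤ L) → (∀ a, |q a| ≤ C) → (∀ x, |ψ x| ≤ D) →
      (∀ x, x ∉ Metric.closedBall 0 R → ψ x = 0) → LocallyIntegrable f →
      (∀ n, Integrable fun x => p (moll n u x) * q (moll n v x) * ψ x * moll n f x) ∧
      Integrable (fun x => p (u x) * q (v x) * ψ x * f x) ∧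
      Tendsto (fun n => ∫ x, p (moll n u x) * q (moll n v x) * ψ x * moll n f x) atTop
        (𝓝 (∫ x, p (u x) * q (v x) * ψ x * f x)) := by
    intro p q ψ f hp hq hψ hpL hqC hψD hψR hf
    have hcont : ∀ n, Continuous fun x => p (moll n u x) * q (moll n v x) * ψ x := fun n =>
      ((hp.comp (hUc n)).mul (hq.comp (hVc n))).mul hψ
    have hbR : ∀ n x, x ∉ Metric.closedBall 0 R →
        p (moll n u x) * q (moll n v x) * ψ x = 0 := fun n x hx => by rw [hψR x hx, mul_zero]
    have hbC : ∀ n x, |p (moll n u x) * q (moll n v x) * ψ x| ≤ L * C * D := by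
      intro n x
      by_cases hx : x ∈ Metric.closedBall 0 R
      · rw [abs_mul, abs_mul]
        have h1 := hpL _ (hUM n x hx)
        have h2 := hqC (moll n v x)
        have h3 := hψD x
        gcongr
      · rw [hbR n x hx, abs_zero]
        positivity
    have hlim : ∀ᵐ x ∂(volume : Measure (EuclideanSpace ℝ (Fin N))),
        Tendsto (fun n => p (moll n u x) * q (moll n v x) * ψ x) atTop
          (𝓝 (p (u x) * q (v x) * ψ x)) := by
      filter_upwards [tendsto_moll_ae hu, tendsto_moll_ae hv] with x hx1 hx2
      exact (((hp.tendsto _).comp hx1).mul ((hq.tendsto _).comp hx2)).mul_const _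
    refine ⟨fun n => ?_, integrable_mul_of_tendsto_of_bounded hf
      (fun n => (hcont n).aestronglyMeasurable) hbC hbR hlim,
      tendsto_integral_mul_moll hf (fun n => (hcont n).aestronglyMeasurable) hbC hbR hlim⟩
    refine ((hcont n).mul (contDiff_moll n hf).continuous).integrable_of_hasCompactSupport ?_
    refine HasCompactSupport.of_support_subset_isCompact (isCompact_closedBall 0 R) fun x hx => ?_
    by_contra hxR
    exact hx (by simp [hψR x hxR])
  have hout₁ : ∀ x, x ∉ Metric.closedBall 0 R → φ x = 0 := fun x hx =>
    hR₁ x fun h => hx (Metric.closedBall_subset_closedBall (le_max_left _ _) h)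
  have hout₂ : ∀ x, x ∉ Metric.closedBall 0 R → pd N i φ x = 0 := fun x hx =>
    hR₂ x fun h => hx (Metric.closedBall_subset_closedBall (le_max_right _ _) h)
  have hAL : ∀ a ∈ Set.Icc (-M) M, |P a| ≤ L := fun a ha =>
    (hA a ha).trans ((le_max_left _ _).trans (le_max_left _ _))
  have hAL' : ∀ a ∈ Set.Icc (-M) M, |P' a| ≤ L := fun a ha =>
    (hA' a ha).trans ((le_max_right _ _).trans (le_max_left _ _))
  have hDφ : ∀ x, |φ x| ≤ D := fun x => (hD₁ x).trans (le_max_left _ _)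
  have hDdφ : ∀ x, |pd N i φ x| ≤ D := fun x => (hD₂ x).trans (le_max_right _ _)
  obtain ⟨i₀, j₀, t₀⟩ := key (f := fun _ => 1) hPc hQc hdφ.continuous hAL hQC hDdφ hout₂
    (locallyIntegrable_const 1)
  obtain ⟨i₁, j₁, t₁⟩ := key hP' hQc hφ.continuous hAL' hQC hDφ hout₁ hw
  obtain ⟨i₂, j₂, t₂⟩ := key hPc hQ' hφ.continuous hAL hQC' hDφ hout₁ hz
  simp only [moll_one, mul_one] at i₀ t₀
  have hparts : ∀ n, ∫ x, P (moll n u x) * Q (moll n v x) * pd N i φ x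
      = -((∫ x, P' (moll n u x) * Q (moll n v x) * φ x * moll n w x)
        + ∫ x, P (moll n u x) * Q' (moll n v x) * φ x * moll n z x) := by
    intro n
    have hU : Differentiable ℝ (moll n u) := (contDiff_moll n hu).differentiable (by simp)
    have hV : Differentiable ℝ (moll n v) := (contDiff_moll n hv).differentiable (by simp)
    have hF : ∀ x, HasFDerivAt (fun x => P (moll n u x) * Q (moll n v x))
        (P (moll n u x) • (Q' (moll n v x) • fderiv ℝ (moll n v) x)
          + Q (moll n v x) • (P' (moll n u x) • fderiv ℝ (moll n u) x)) x := fun x =>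
      ((hP _).comp_hasFDerivAt x (hU x).hasFDerivAt).mul
        ((hQ _).comp_hasFDerivAt x (hV x).hasFDerivAt)
    have hpd : ∀ x, fderiv ℝ (fun x => P (moll n u x) * Q (moll n v x)) x
        (EuclideanSpace.single i 1) * φ x = P' (moll n u x) * Q (moll n v x) * φ x * moll n w x
          + P (moll n u x) * Q' (moll n v x) * φ x * moll n z x := by
      intro x
      have h1 : fderiv ℝ (moll n u) x (EuclideanSpace.single i 1) = moll n w x :=
        congrFun (pd_moll n hu huw) x
      have h2 : fderiv ℝ (moll n v) x (EuclideanSpace.single i 1) = moll n z x :=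
        congrFun (pd_moll n hv hvz) x
      rw [(hF x).fderiv]
      simp only [add_apply, smul_apply, smul_eq_mul, h1, h2]
      ring
    have hmain := integral_mul_fderiv_eq_neg_fderiv_mul_of_integrable
      (μ := (volume : Measure (EuclideanSpace ℝ (Fin N)))) (𝕜 := ℝ)
      (f := fun x => P (moll n u x) * Q (moll n v x)) (g := φ) (v := EuclideanSpace.single i 1)
      ?_ (i₀ n) ?_ (fun x _ => (hF x).differentiableAt)
      fun x _ => hφ.differentiable (by simp) x
    · simp only [hpd] at hmain
      rw [integral_add (i₁ n) (i₂ n)] at hmain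
      exact hmain
    · simp only [hpd]
      exact (i₁ n).add (i₂ n)
    · exact (((hPc.comp (hUc n)).mul (hQc.comp (hVc n))).mul
        hφ.continuous).integrable_of_hasCompactSupport hφc.mul_left
  have hlim := tendsto_nhds_unique t₀ (by simp only [hparts]; exact (t₁.add t₂).neg)
  rw [hlim, ← integral_add j₁ j₂]
  congr 1
  refine integral_congr_ae (Eventually.of_forall fun x => ?_)
  simp only
  ring

end ChainRule

section LocalIntegrability

variable {N : ℕ} {f b v z : EuclideanSpace ℝ (Fin N) → ℝ}

lemma exists_contDiff_eq_one_on_closedBall (N : ℕ) (R : ℝ) :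
    ∃ χ : EuclideanSpace ℝ (Fin N) → ℝ, ContDiff ℝ ∞ χ ∧ HasCompactSupport χ ∧
      ∀ x ∈ Metric.closedBall 0 R, χ x = 1 := by
  let f : ContDiffBump (0 : EuclideanSpace ℝ (Fin N)) :=
    ⟨max R 1, max R 1 + 1, by positivity, by linarith⟩
  exact ⟨f, f.contDiff, f.hasCompactSupport, fun x hx =>
    f.one_of_mem_closedBall (Metric.closedBall_subset_closedBall (le_max_left _ _) hx)⟩

lemma locallyIntegrable_of_sq (hf : AEStronglyMeasurable f)
    (h : ∀ K, IsCompact K → IntegrableOn (fun x => f x ^ 2) K) : LocallyIntegrable f := by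
  rw [locallyIntegrable_iff]
  intro K hK
  have : IsFiniteMeasure (volume.restrict K) := ⟨by simpa using hK.measure_lt_top⟩
  exact ((memLp_two_iff_integrable_sq hf.restrict).2 (h K hK)).integrable (by norm_num)

lemma locallyIntegrable_linftyLoc_mul (hf : LocallyIntegrable f)
    (hbm : AEStronglyMeasurable b) (hb : LinftyLoc N b) :
    LocallyIntegrable (fun x => b x * f x) := by
  rw [locallyIntegrable_iff]
  intro K hK
  obtain ⟨C, hC⟩ := hb K hK
  exact Integrable.bdd_mul (c := C) (hf.integrableOn_isCompact hK) hbm.restrict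
    (ae_restrict_of_ae_restrict_of_subset subset_rfl
      ((ae_restrict_iff' hK.measurableSet).2 hC))

lemma integrable_mul_test {φ : EuclideanSpace ℝ (Fin N) → ℝ} (hf : LocallyIntegrable f)
    (hφ : Continuous φ) (hφc : HasCompactSupport φ) : Integrable (fun x => f x * φ x) := by
  simpa [smul_eq_mul] using hf.integrable_smul_right_of_hasCompactSupport hφ hφc

lemma linftyLoc_of_abs_le {C : ℝ} (h : ∀ x, |b x| ≤ C) : LinftyLoc N b :=
  fun _ _ => ⟨C, ae_of_all _ fun x _ => h x⟩

lemma LinftyLoc.comp_continuous {P : ℝ → ℝ} (h : LinftyLoc N b) (hP : Continuous P) :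
    LinftyLoc N (fun x => P (b x)) := by
  intro K hK
  obtain ⟨M, hM⟩ := h K hK
  obtain ⟨A, hA⟩ := (isCompact_Icc (a := -M) (b := M)).exists_bound_of_continuousOn
    hP.continuousOn
  exact ⟨A, by filter_upwards [hM] with x hx hxK using hA _ (abs_le.1 (hx hxK))⟩

lemma ae_eq_zero_of_integral_mul_test_eq_zero (hf : LocallyIntegrable f)
    (h : ∀ φ : EuclideanSpace ℝ (Fin N) → ℝ, ContDiff ℝ ∞ φ → HasCompactSupport φ →
      ∫ x, f x * φ x = 0) : ∀ᵐ x, f x = 0 :=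
  ae_eq_zero_of_integral_contDiff_smul_eq_zero hf fun φ hφ hφc => by
    simpa [smul_eq_mul, mul_comm] using h φ hφ hφc

end LocalIntegrability

section Truncation

/-- A bounded smooth modification of the identity. -/
noncomputable def tame (m a : ℝ) : ℝ := a / (1 + (m * a) ^ 2)

/-- The derivative of `tame`. -/
noncomputable def tameDeriv (m a : ℝ) : ℝ := (1 - (m * a) ^ 2) / (1 + (m * a) ^ 2) ^ 2

lemma hasDerivAt_tame (m a : ℝ) : HasDerivAt (tame m) (tameDeriv m a) a := by
  have h1 : HasDerivAt (fun a : ℝ => 1 + (m * a) ^ 2) (2 * (m * a) * m) a := by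
    simpa using ((((hasDerivAt_id a).const_mul m).pow 2).const_add 1)
  refine ((hasDerivAt_id a).div h1 (by positivity)).congr_deriv ?_
  rw [tameDeriv]
  congr 1
  simp only [id]
  ring

lemma continuous_tameDeriv (m : ℝ) : Continuous (tameDeriv m) :=
  (by fun_prop : Continuous fun a : ℝ => 1 - (m * a) ^ 2).div (by fun_prop) fun a => by positivity

lemma continuous_tame (m : ℝ) : Continuous (tame m) :=
  continuous_iff_continuousAt.2 fun a => (hasDerivAt_tame m a).continuousAt

lemma abs_tame_le_abs (m a : ℝ) : |tame m a| ≤ |a| := by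
  rw [tame, abs_div, abs_of_pos (by positivity : 0 < 1 + (m * a) ^ 2)]
  exact div_le_self (abs_nonneg _) (by nlinarith [sq_nonneg (m * a)])

lemma abs_tame_le {m : ℝ} (hm : 0 < m) (a : ℝ) : |tame m a| ≤ 1 / m := by
  rw [tame, abs_div, abs_of_pos (by positivity : 0 < 1 + (m * a) ^ 2),
    div_le_div_iff₀ (by positivity) hm]
  rw [← sq_abs, abs_mul, abs_of_pos hm]
  nlinarith [sq_nonneg (m * |a| - 1), abs_nonneg a]

lemma abs_tameDeriv_le (m a : ℝ) : |tameDeriv m a| ≤ 1 := by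
  rw [tameDeriv, abs_div, abs_of_pos (by positivity : 0 < (1 + (m * a) ^ 2) ^ 2),
    div_le_one (by positivity), abs_le]
  constructor <;> nlinarith [sq_nonneg (m * a), sq_nonneg ((m * a) ^ 2)]

lemma tendsto_tame_zero (a : ℝ) :
    Tendsto (fun k : ℕ => tame (1 / ((k : ℝ) + 1)) a) atTop (𝓝 a) := by
  have h := tendsto_one_div_add_atTop_nhds_zero_nat (𝕜 := ℝ)
  have h2 := (tendsto_const_nhds (x := a)).div (((h.mul_const a).pow 2).const_add 1) (by simp)
  simp only [zero_mul, ne_eq, OfNat.ofNat_ne_zero, not_false_eq_true, zero_pow, add_zero,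
    div_one] at h2
  exact h2

lemma tendsto_tameDeriv_zero (a : ℝ) :
    Tendsto (fun k : ℕ => tameDeriv (1 / ((k : ℝ) + 1)) a) atTop (𝓝 1) := by
  have h := tendsto_one_div_add_atTop_nhds_zero_nat (𝕜 := ℝ)
  have h2 := (((h.mul_const a).pow 2).const_sub 1).div
    ((((h.mul_const a).pow 2).const_add 1).pow 2) (by simp)
  simp only [zero_mul, ne_eq, OfNat.ofNat_ne_zero, not_false_eq_true, zero_pow, add_zero, sub_zero,
    one_pow, div_one] at h2
  exact h2

lemma tendsto_tameDeriv_atTop (a : ℝ) :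
    Tendsto (fun k : ℕ => tameDeriv ((k : ℝ) + 1) a) atTop (𝓝 (if a = 0 then 1 else 0)) := by
  split_ifs with ha
  · simp [tameDeriv, ha]
  have hk : Tendsto (fun k : ℕ => (k : ℝ) + 1) atTop atTop :=
    tendsto_atTop_add_const_right _ _ tendsto_natCast_atTop_atTop
  have h : Tendsto (fun k : ℕ => 1 + (((k : ℝ) + 1) * a) ^ 2) atTop atTop := by
    refine tendsto_atTop_add_const_left _ _ ?_
    simp only [mul_pow]
    exact ((tendsto_pow_atTop two_ne_zero).comp hk).atTop_mul_const (by positivity)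
  refine squeeze_zero_norm (fun k => ?_) h.inv_tendsto_atTop
  rw [Real.norm_eq_abs, tameDeriv, abs_div, Pi.inv_apply, inv_eq_one_div,
    abs_of_pos (by positivity : 0 < (1 + (((k : ℝ) + 1) * a) ^ 2) ^ 2),
    div_le_div_iff₀ (by positivity) (by positivity)]
  have : |1 - (((k : ℝ) + 1) * a) ^ 2| ≤ 1 + (((k : ℝ) + 1) * a) ^ 2 := by
    rw [abs_le]
    constructor <;> nlinarith [sq_nonneg (((k : ℝ) + 1) * a)]
  nlinarith [sq_nonneg (((k : ℝ) + 1) * a)]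

end Truncation

section WeakDerivativeRules

variable {N : ℕ} {i : Fin N} {u w v z : EuclideanSpace ℝ (Fin N) → ℝ}

lemma isWeakPd_zero : IsWeakPd N i (fun _ => 0) (fun _ => 0) := fun φ _ _ => by simp

lemma IsWeakPd.comp {P P' : ℝ → ℝ} (hu : LocallyIntegrable u) (hub : LinftyLoc N u)
    (hw : LocallyIntegrable w) (huw : IsWeakPd N i u w)
    (hP : ∀ a, HasDerivAt P (P' a) a) (hP' : Continuous P') :
    IsWeakPd N i (fun x => P (u x)) (fun x => P' (u x) * w x) := by
  have h0 : LocallyIntegrable (fun _ : EuclideanSpace ℝ (Fin N) => (0 : ℝ)) :=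
    locallyIntegrable_const 0
  simpa using IsWeakPd.comp_mul_comp (Q := fun _ => 1) (Q' := fun _ => 0) (C := 1) hu hub hw h0 h0
    huw isWeakPd_zero hP hP' (fun a => hasDerivAt_const a 1) continuous_const (by simp) (by simp)

lemma IsWeakPd.ae_eq_zero_of_eq_zero (hv : LocallyIntegrable v) (hz : LocallyIntegrable z)
    (h : IsWeakPd N i v z) : ∀ᵐ x, v x = 0 → z x = 0 := by
  have h0 : LocallyIntegrable (fun _ : EuclideanSpace ℝ (Fin N) => (0 : ℝ)) :=
    locallyIntegrable_const 0
  have hm : ∀ k : ℕ, AEStronglyMeasurable (fun x => tameDeriv ((k : ℝ) + 1) (v x)) := fun k =>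
    (continuous_tameDeriv _).comp_aestronglyMeasurable hv.aestronglyMeasurable
  have hlim : ∀ x, Tendsto (fun k : ℕ => tameDeriv ((k : ℝ) + 1) (v x)) atTop
      (𝓝 (if v x = 0 then 1 else 0)) := fun x => tendsto_tameDeriv_atTop _
  have hLI : LocallyIntegrable (fun x => (if v x = 0 then 1 else 0) * z x) :=
    locallyIntegrable_linftyLoc_mul hz
      (aestronglyMeasurable_of_tendsto_ae atTop hm (ae_of_all _ hlim))
      (linftyLoc_of_abs_le (C := 1) fun x => by split_ifs <;> simp)
  have key := ae_eq_zero_of_integral_mul_test_eq_zero hLI fun φ hφ hφc => ?_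
  · filter_upwards [key] with x hx hvx
    simpa [hvx] using hx
  have hk : ∀ k : ℕ, ∫ x, tame ((k : ℝ) + 1) (v x) * pd N i φ x
      = -∫ x, tameDeriv ((k : ℝ) + 1) (v x) * z x * φ x := by
    intro k
    have := IsWeakPd.comp_mul_comp (u := fun _ => 0) (w := fun _ => 0) (P := fun _ => 1)
      (P' := fun _ => 0) (Q := tame ((k : ℝ) + 1)) (C := 1) h0
      (linftyLoc_of_abs_le (C := 0) (by simp)) h0 hv hz isWeakPd_zero h
      (fun a => hasDerivAt_const a 1) continuous_const
      (hasDerivAt_tame _) (continuous_tameDeriv _)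
      (fun a => (abs_tame_le (by positivity) a).trans ?_) (abs_tameDeriv_le _) φ hφ hφc
    · simpa using this
    · rw [div_le_one (by positivity)]
      linarith [(Nat.cast_nonneg k : (0 : ℝ) ≤ k)]
  have hφi : Integrable (pd N i φ) := (contDiff_pd i hφ).continuous.integrable_of_hasCompactSupport
    (hasCompactSupport_pd i hφc)
  have hzφ := integrable_mul_test hz hφ.continuous hφc
  have hinv : Tendsto (fun k : ℕ => 1 / ((k : ℝ) + 1)) atTop (𝓝 0) :=
    tendsto_one_div_add_atTop_nhds_zero_nat
  have t₁ : Tendsto (fun k : ℕ => ∫ x, tame ((k : ℝ) + 1) (v x) * pd N i φ x) atTop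
      (𝓝 (∫ _ : EuclideanSpace ℝ (Fin N), (0 : ℝ))) := by
    refine tendsto_integral_of_dominated_convergence (fun x => |pd N i φ x|)
      (fun k => ((continuous_tame _).comp_aestronglyMeasurable hv.aestronglyMeasurable).mul
        hφi.aestronglyMeasurable) hφi.abs (fun k => ae_of_all _ fun x => ?_)
      (ae_of_all _ fun x => ?_)
    · rw [Real.norm_eq_abs, abs_mul]
      refine mul_le_of_le_one_left (abs_nonneg _)
        ((abs_tame_le (by positivity) (v x)).trans ?_)
      rw [div_le_one (by positivity)]
      linarith [(Nat.cast_nonneg k : (0 : ℝ) ≤ k)]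
    · have : Tendsto (fun k : ℕ => tame ((k : ℝ) + 1) (v x)) atTop (𝓝 0) :=
        squeeze_zero_norm (fun k => abs_tame_le (by positivity) (v x)) hinv
      simpa using this.mul_const (pd N i φ x)
  have t₂ : Tendsto (fun k : ℕ => ∫ x, tameDeriv ((k : ℝ) + 1) (v x) * z x * φ x) atTop
      (𝓝 (∫ x, (if v x = 0 then 1 else 0) * z x * φ x)) := by
    refine tendsto_integral_of_dominated_convergence (fun x => |z x * φ x|)
      (fun k => ?_) hzφ.abs (fun k => ae_of_all _ fun x => ?_)
      (ae_of_all _ fun x => ((hlim x).mul_const _).mul_const _)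
    · simp only [mul_assoc]
      exact (hm k).mul hzφ.aestronglyMeasurable
    · rw [Real.norm_eq_abs, mul_assoc, abs_mul]
      exact mul_le_of_le_one_left (abs_nonneg _) (abs_tameDeriv_le _ _)
  have := tendsto_nhds_unique t₁ (by simp only [hk]; exact t₂.neg)
  simpa using this

lemma IsWeakPd.comp_mul {P P' : ℝ → ℝ} (hu : LocallyIntegrable u) (hub : LinftyLoc N u)
    (hw : LocallyIntegrable w) (hv : LocallyIntegrable v) (hz : LocallyIntegrable z)
    (hvw : LocallyIntegrable fun x => v x * w x)
    (huw : IsWeakPd N i u w) (hvz : IsWeakPd N i v z)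
    (hP : ∀ a, HasDerivAt P (P' a) a) (hP' : Continuous P') :
    IsWeakPd N i (fun x => P (u x) * v x)
      (fun x => P' (u x) * (v x * w x) + P (u x) * z x) := by
  intro φ hφ hφc
  have hPc : Continuous P := continuous_iff_continuousAt.2 fun a => (hP a).continuousAt
  have hPm := hPc.comp_aestronglyMeasurable hu.aestronglyMeasurable
  have hPm' := hP'.comp_aestronglyMeasurable hu.aestronglyMeasurable
  set m : ℕ → ℝ := fun k => 1 / ((k : ℝ) + 1)
  have hm : ∀ k, 0 < m k := fun k => by positivity
  have hTm : ∀ k, AEStronglyMeasurable (fun x => tame (m k) (v x)) := fun k =>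
    (continuous_tame _).comp_aestronglyMeasurable hv.aestronglyMeasurable
  have hTm' : ∀ k, AEStronglyMeasurable (fun x => tameDeriv (m k) (v x)) := fun k =>
    (continuous_tameDeriv _).comp_aestronglyMeasurable hv.aestronglyMeasurable
  have hk := fun k : ℕ => IsWeakPd.comp_mul_comp (Q := tame (m k)) (C := (k : ℝ) + 1)
    hu hub hw hv hz huw hvz hP hP' (hasDerivAt_tame _) (continuous_tameDeriv _)
      (fun a => (abs_tame_le (hm k) a).trans (by simp [m]))
      (fun a => (abs_tameDeriv_le _ _).trans (by simp)) φ hφ hφc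
  have j₀ := integrable_mul_test
    (locallyIntegrable_linftyLoc_mul hv hPm (hub.comp_continuous hPc))
    (contDiff_pd i hφ).continuous (hasCompactSupport_pd i hφc)
  have j₁ := integrable_mul_test
    (locallyIntegrable_linftyLoc_mul hvw hPm' (hub.comp_continuous hP')) hφ.continuous hφc
  have j₂ := integrable_mul_test
    (locallyIntegrable_linftyLoc_mul hz hPm (hub.comp_continuous hPc)) hφ.continuous hφc
  have t₀ : Tendsto (fun k => ∫ x, P (u x) * tame (m k) (v x) * pd N i φ x) atTop
      (𝓝 (∫ x, P (u x) * v x * pd N i φ x)) := by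
    refine tendsto_integral_of_dominated_convergence _ (fun k => (hPm.mul (hTm k)).mul
      (contDiff_pd i hφ).continuous.aestronglyMeasurable) j₀.abs
      (fun k => ae_of_all _ fun x => ?_) (ae_of_all _ fun x => ?_)
    · simp only [Real.norm_eq_abs, abs_mul]
      have := abs_tame_le_abs (m k) (v x)
      gcongr
    · exact ((tendsto_tame_zero _).const_mul _).mul_const _
  have t₁ : Tendsto (fun k => ∫ x, (P' (u x) * tame (m k) (v x) * w x
      + P (u x) * tameDeriv (m k) (v x) * z x) * φ x) atTop
      (𝓝 (∫ x, (P' (u x) * (v x * w x) + P (u x) * z x) * φ x)) := by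
    refine tendsto_integral_of_dominated_convergence _ (fun k =>
      ((((hPm'.mul (hTm k)).mul hw.aestronglyMeasurable).add
        ((hPm.mul (hTm' k)).mul hz.aestronglyMeasurable)).mul
      hφ.continuous.aestronglyMeasurable)) (j₁.abs.add j₂.abs)
      (fun k => ae_of_all _ fun x => ?_) (ae_of_all _ fun x => ?_)
    · rw [add_mul]
      refine (norm_add_le _ _).trans (add_le_add ?_ ?_)
      · simp only [Real.norm_eq_abs, abs_mul, ← mul_assoc]
        have := abs_tame_le_abs (m k) (v x)
        gcongr
      · simp only [Real.norm_eq_abs, abs_mul]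
        gcongr
        exact mul_le_of_le_one_right (abs_nonneg _) (abs_tameDeriv_le _ _)
    · have h1 := ((tendsto_tame_zero (v x)).const_mul (P' (u x))).mul_const (w x)
      have h2 := ((tendsto_tameDeriv_zero (v x)).const_mul (P (u x))).mul_const (z x)
      simpa only [mul_assoc, mul_one, one_mul] using (h1.add h2).mul_const (φ x)
  exact tendsto_nhds_unique t₀ (by simp only [hk]; exact t₁.neg)

/-- A nonnegative function that is affine along a coordinate direction is constant along it. -/
lemma IsWeakPd.ae_eq_zero_of_nonneg_of_zero (hu : LocallyIntegrable u) (hw : LocallyIntegrable w)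
    (hpos : ∀ᵐ x, 0 ≤ u x) (huw : IsWeakPd N i u w) (hw0 : IsWeakPd N i w fun _ => 0) :
    ∀ᵐ x, w x = 0 := by
  have key : ∀ n x, moll n w x = 0 := by
    intro n x
    set e : EuclideanSpace ℝ (Fin N) := EuclideanSpace.single i 1
    have hline : ∀ t : ℝ, HasDerivAt (fun t : ℝ => x + t • e) e t := fun t => by
      simpa using ((hasDerivAt_id t).smul_const e).const_add x
    have hder : ∀ f f' : EuclideanSpace ℝ (Fin N) → ℝ, LocallyIntegrable f → IsWeakPd N i f f' →
        ∀ t : ℝ, HasDerivAt (fun t : ℝ => moll n f (x + t • e)) (moll n f' (x + t • e)) t := by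
      intro f f' hf hff' t
      rw [← pd_moll n hf hff']
      exact (((contDiff_moll n hf).differentiable (by simp)) _).hasFDerivAt.comp_hasDerivAt t
        (hline t)
    have hz : ∀ y : EuclideanSpace ℝ (Fin N), moll n (fun _ => (0 : ℝ)) y = 0 := fun y => by
      simp [moll]
    have hwc : ∀ t : ℝ, moll n w (x + t • e) = moll n w x := by
      intro t
      have := is_const_of_deriv_eq_zero (f := fun t : ℝ => moll n w (x + t • e))
        (fun t => (hder w _ hw hw0 t).differentiableAt)
        (fun t => by rw [(hder w _ hw hw0 t).deriv, hz]) t 0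
      simpa using this
    have haff : ∀ t : ℝ, moll n u (x + t • e) - t * moll n w x = moll n u x := by
      intro t
      have hd : ∀ t : ℝ, HasDerivAt (fun t : ℝ => moll n u (x + t • e) - t * moll n w x) 0 t := by
        intro t
        refine ((hder u w hu huw t).sub ((hasDerivAt_id t).mul_const (moll n w x))).congr_deriv ?_
        rw [hwc, one_mul, sub_self]
      have := is_const_of_deriv_eq_zero (fun t => (hd t).differentiableAt)
        (fun t => (hd t).deriv) t 0
      simpa using this
    by_contra hne
    have h1 := haff (-(moll n u x + 1) / moll n w x)
    rw [div_mul_cancel₀ _ hne] at h1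
    linarith [moll_nonneg n (x + (-(moll n u x + 1) / moll n w x) • e) hpos]
  filter_upwards [tendsto_moll_ae hw] with x hx
  simp only [key] at hx
  exact tendsto_nhds_unique hx tendsto_const_nhds

end WeakDerivativeRules

section FourthPower

/-- A bounded smooth modification of the cube. -/
noncomputable def tameCube (δ s : ℝ) : ℝ := s ^ 3 / (1 + δ * s ^ 4)

/-- The derivative of `tameCube`. -/
noncomputable def tameCubeDeriv (δ s : ℝ) : ℝ := (3 * s ^ 2 - δ * s ^ 6) / (1 + δ * s ^ 4) ^ 2

lemma hasDerivAt_tameCube {δ : ℝ} (hδ : 0 ≤ δ) (s : ℝ) :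
    HasDerivAt (tameCube δ) (tameCubeDeriv δ s) s := by
  have h1 : HasDerivAt (fun s : ℝ => 1 + δ * s ^ 4) (δ * (4 * s ^ 3)) s := by
    simpa using (((hasDerivAt_pow 4 s).const_mul δ).const_add 1)
  have h2 : HasDerivAt (fun s : ℝ => s ^ 3) (3 * s ^ 2) s := by simpa using hasDerivAt_pow 3 s
  refine (h2.div h1 (by positivity)).congr_deriv ?_
  rw [tameCubeDeriv]
  congr 1
  ring

lemma continuous_tameCubeDeriv {δ : ℝ} (hδ : 0 ≤ δ) : Continuous (tameCubeDeriv δ) :=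
  (by fun_prop : Continuous fun s : ℝ => 3 * s ^ 2 - δ * s ^ 6).div (by fun_prop)
    fun s => by positivity

lemma abs_tameCube {δ : ℝ} (hδ : 0 ≤ δ) (s : ℝ) :
    |tameCube δ s| = |s| ^ 3 * (1 + δ * s ^ 4)⁻¹ := by
  rw [tameCube, abs_div, abs_of_pos (by positivity : 0 < 1 + δ * s ^ 4), abs_pow, div_eq_mul_inv]

lemma abs_tameCubeDeriv_le {δ : ℝ} (hδ : 0 ≤ δ) (s : ℝ) :
    |tameCubeDeriv δ s| ≤ 3 * s ^ 2 * (1 + δ * s ^ 4)⁻¹ := by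
  rw [tameCubeDeriv, abs_div, abs_of_pos (by positivity : 0 < (1 + δ * s ^ 4) ^ 2),
    ← div_eq_mul_inv, div_le_div_iff₀ (by positivity) (by positivity)]
  have h6 : 0 ≤ δ * s ^ 6 := by positivity
  have : |3 * s ^ 2 - δ * s ^ 6| ≤ 3 * s ^ 2 * (1 + δ * s ^ 4) := by
    rw [abs_le]
    constructor <;> nlinarith [sq_nonneg s]
  calc _ ≤ 3 * s ^ 2 * (1 + δ * s ^ 4) * (1 + δ * s ^ 4) := by gcongr
    _ = _ := by ring

lemma abs_tameCube_le {δ : ℝ} (hδ : 0 < δ) (hδ1 : δ ≤ 1) (s : ℝ) : |tameCube δ s| ≤ 3 / δ := by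
  rw [abs_tameCube hδ.le, ← div_eq_mul_inv, div_le_div_iff₀ (by positivity) hδ,
    ← (by decide : Even 4).pow_abs s]
  have h : |s| ^ 3 ≤ 1 + |s| ^ 4 := by
    nlinarith [abs_nonneg s, sq_nonneg (|s| ^ 2 - |s|), sq_nonneg (|s| - 1),
      sq_nonneg (|s| ^ 2 - 1)]
  nlinarith [mul_le_mul_of_nonneg_left h hδ.le, pow_nonneg (abs_nonneg s) 4]

lemma abs_tameCubeDeriv_le_div {δ : ℝ} (hδ : 0 < δ) (hδ1 : δ ≤ 1) (s : ℝ) :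
    |tameCubeDeriv δ s| ≤ 3 / δ := by
  refine (abs_tameCubeDeriv_le hδ.le s).trans ?_
  rw [← div_eq_mul_inv, div_le_div_iff₀ (by positivity) hδ]
  have h : s ^ 2 ≤ 1 + s ^ 4 := by nlinarith [sq_nonneg (s ^ 2 - 1), sq_nonneg s]
  nlinarith [mul_le_mul_of_nonneg_left h hδ.le]

lemma tameCube_absorb {M δ s a h c d : ℝ} (hδ : 0 ≤ δ) (ha : |a| ≤ M) :
    -(a * tameCubeDeriv δ s * h * c ^ 2) - a * tameCube δ s * (2 * c * d) ≤
      1 / 2 * (tameCube δ s * s * c ^ 2) + (9 * M ^ 2 * (h ^ 2 * c ^ 2)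
        + 4 * M ^ 2 * (s ^ 2 * d ^ 2)) := by
  have hM : 0 ≤ M := (abs_nonneg a).trans ha
  set q := (1 + δ * s ^ 4)⁻¹ with hq
  have hq0 : 0 ≤ q := by positivity
  have hq1 : q ≤ 1 := inv_le_one_of_one_le₀ (by
    nlinarith [mul_nonneg hδ (by positivity : 0 ≤ s ^ 4)])
  have hA : tameCube δ s * s * c ^ 2 = q * (s ^ 4 * c ^ 2) := by
    rw [tameCube, div_eq_mul_inv, ← hq]; ring
  have hB : -(a * tameCubeDeriv δ s * h * c ^ 2) ≤ q * (3 * M * s ^ 2 * |h| * c ^ 2) := by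
    refine (neg_le_abs _).trans ?_
    rw [abs_mul, abs_mul, abs_mul, abs_of_nonneg (sq_nonneg c)]
    calc _ ≤ M * (3 * s ^ 2 * q) * |h| * c ^ 2 := by
          have := abs_tameCubeDeriv_le hδ s
          gcongr
      _ = _ := by ring
  have hE : -(a * tameCube δ s * (2 * c * d)) ≤ q * (2 * M * |s| ^ 3 * |c| * |d|) := by
    refine (neg_le_abs _).trans ?_
    rw [abs_mul, abs_mul, abs_mul, abs_mul, abs_tameCube hδ, ← hq, abs_two]
    calc _ ≤ M * (|s| ^ 3 * q) * (2 * |c| * |d|) := by gcongr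
      _ = _ := by ring
  have hB' : 3 * M * s ^ 2 * |h| * c ^ 2 ≤
      1 / 4 * (s ^ 4 * c ^ 2) + 9 * M ^ 2 * (h ^ 2 * c ^ 2) := by
    rw [← sq_abs h]
    nlinarith [mul_nonneg (sq_nonneg (s ^ 2 / 2 - 3 * M * |h|)) (sq_nonneg c)]
  have hE' : 2 * M * |s| ^ 3 * |c| * |d| ≤
      1 / 4 * (s ^ 4 * c ^ 2) + 4 * M ^ 2 * (s ^ 2 * d ^ 2) := by
    rw [← (by decide : Even 4).pow_abs s, ← sq_abs c, ← sq_abs d, ← sq_abs s]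
    nlinarith [sq_nonneg (|s| ^ 2 * |c| / 2 - 2 * M * |s| * |d|)]
  have hsum := mul_le_mul_of_nonneg_left (add_le_add hB' hE') hq0
  have hD : q * (9 * M ^ 2 * (h ^ 2 * c ^ 2) + 4 * M ^ 2 * (s ^ 2 * d ^ 2))
      ≤ 9 * M ^ 2 * (h ^ 2 * c ^ 2) + 4 * M ^ 2 * (s ^ 2 * d ^ 2) :=
    mul_le_of_le_one_left (by positivity) hq1
  rw [hA]
  linarith

variable {N : ℕ} {i : Fin N} {u G H : EuclideanSpace ℝ (Fin N) → ℝ}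

lemma integral_tameCube_le {χ : EuclideanSpace ℝ (Fin N) → ℝ} {M δ : ℝ} (hu : LocallyIntegrable u)
    (hub : LinftyLoc N u) (hG : LocallyIntegrable G) (hH : LocallyIntegrable H)
    (hG2 : LocallyIntegrable fun x => G x ^ 2) (hH2 : LocallyIntegrable fun x => H x ^ 2)
    (huG : IsWeakPd N i u G) (hGH : IsWeakPd N i G H) (hχ : ContDiff ℝ ∞ χ)
    (hχc : HasCompactSupport χ) (hM : ∀ᵐ x, x ∈ tsupport χ → |u x| ≤ M)
    (hδ : 0 < δ) (hδ1 : δ ≤ 1) :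
    Integrable (fun x => tameCube δ (G x) * G x * χ x ^ 2) ∧
    ∫ x, tameCube δ (G x) * G x * χ x ^ 2 ≤
      2 * ∫ x, (9 * M ^ 2 * (H x ^ 2 * χ x ^ 2) + 4 * M ^ 2 * (G x ^ 2 * pd N i χ x ^ 2)) := by
  have hΦ : Continuous (tameCube δ) :=
    continuous_iff_continuousAt.2 fun a => (hasDerivAt_tameCube hδ.le a).continuousAt
  have hΦ' := continuous_tameCubeDeriv hδ.le
  have hχ2 : ContDiff ℝ ∞ fun x => χ x ^ 2 := hχ.pow 2
  have hcχ : HasCompactSupport fun x => χ x ^ 2 :=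
    hχc.comp_left (g := fun a : ℝ => a ^ 2) (by simp)
  have hd := contDiff_pd i hχ
  have hdc := hasCompactSupport_pd i hχc
  have hpd : ∀ x, pd N i (fun x => χ x ^ 2) x = 2 * χ x * pd N i χ x := by
    intro x
    have := ((hχ.differentiable (by simp) x).hasFDerivAt.pow 2).fderiv
    simp only [pd]
    rw [this]
    simp
  have hΦm := hΦ.comp_aestronglyMeasurable hG.aestronglyMeasurable
  have hΦm' := hΦ'.comp_aestronglyMeasurable hG.aestronglyMeasurable
  have hΦb : LinftyLoc N fun x => tameCube δ (G x) :=
    linftyLoc_of_abs_le fun x => abs_tameCube_le hδ hδ1 _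
  have hΦb' : LinftyLoc N fun x => tameCubeDeriv δ (G x) :=
    linftyLoc_of_abs_le fun x => abs_tameCubeDeriv_le_div hδ hδ1 _
  have iA : Integrable fun x => tameCube δ (G x) * G x * χ x ^ 2 :=
    integrable_mul_test (locallyIntegrable_linftyLoc_mul hG hΦm hΦb) hχ2.continuous hcχ
  have iB : Integrable fun x => u x * tameCubeDeriv δ (G x) * H x * χ x ^ 2 := by
    have := integrable_mul_test (locallyIntegrable_linftyLoc_mul
      (locallyIntegrable_linftyLoc_mul hH hΦm' hΦb') hu.aestronglyMeasurable hub)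
      hχ2.continuous hcχ
    simpa only [mul_assoc] using this
  have iE : Integrable fun x => u x * tameCube δ (G x) * (2 * χ x * pd N i χ x) := by
    have := integrable_mul_test (locallyIntegrable_linftyLoc_mul hu hΦm hΦb)
      (contDiff_pd i hχ2).continuous (hasCompactSupport_pd i hcχ)
    simpa only [hpd, mul_comm (tameCube δ _)] using this
  have iH : Integrable fun x => H x ^ 2 * χ x ^ 2 := integrable_mul_test hH2 hχ2.continuous hcχ
  have hd2c : HasCompactSupport fun x => pd N i χ x ^ 2 :=
    hdc.comp_left (g := fun a : ℝ => a ^ 2) (by simp)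
  have iG : Integrable fun x => G x ^ 2 * pd N i χ x ^ 2 :=
    integrable_mul_test hG2 (hd.continuous.pow 2) hd2c
  have iD : Integrable fun x =>
      9 * M ^ 2 * (H x ^ 2 * χ x ^ 2) + 4 * M ^ 2 * (G x ^ 2 * pd N i χ x ^ 2) :=
    (iH.const_mul _).add (iG.const_mul _)
  have iB' : Integrable fun x => -(u x * tameCubeDeriv δ (G x) * H x * χ x ^ 2) := iB.neg
  refine ⟨iA, ?_⟩
  have hweak := IsWeakPd.comp_mul_comp (P := fun a => a) (P' := fun _ => 1) (C := 3 / δ) hu hub hG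
    hG hH huG hGH hasDerivAt_id continuous_const (hasDerivAt_tameCube hδ.le) hΦ'
    (abs_tameCube_le hδ hδ1) (abs_tameCubeDeriv_le_div hδ hδ1) _ hχ2 hcχ
  simp only [hpd, one_mul, add_mul] at hweak
  rw [integral_add iA iB] at hweak
  have hle : ∫ x, (-(u x * tameCubeDeriv δ (G x) * H x * χ x ^ 2)
      - u x * tameCube δ (G x) * (2 * χ x * pd N i χ x)) ≤
      ∫ x, (1 / 2 * (tameCube δ (G x) * G x * χ x ^ 2) +
        (9 * M ^ 2 * (H x ^ 2 * χ x ^ 2) + 4 * M ^ 2 * (G x ^ 2 * pd N i χ x ^ 2))) := by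
    refine integral_mono_ae (iB'.sub iE) ((iA.const_mul _).add iD) ?_
    filter_upwards [hM] with x hx
    by_cases hxχ : x ∈ tsupport χ
    · exact tameCube_absorb hδ.le (hx hxχ)
    · simp only [image_eq_zero_of_notMem_tsupport hxχ]
      have : 0 ≤ 4 * M ^ 2 * (G x ^ 2 * pd N i χ x ^ 2) := by positivity
      simpa using this
  rw [integral_sub iB' iE, integral_neg, integral_add (iA.const_mul _) iD,
    integral_const_mul] at hle
  linarith

/-- The gradient of a locally bounded function with locally square integrable pure second
derivatives is locally in `L⁴`. -/
lemma IsWeakPd.locallyIntegrable_pow_four (hu : LocallyIntegrable u)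
    (hub : LinftyLoc N u) (hG : LocallyIntegrable G) (hH : LocallyIntegrable H)
    (hG2 : LocallyIntegrable fun x => G x ^ 2) (hH2 : LocallyIntegrable fun x => H x ^ 2)
    (huG : IsWeakPd N i u G) (hGH : IsWeakPd N i G H) :
    LocallyIntegrable fun x => G x ^ 4 := by
  rw [locallyIntegrable_iff]
  intro K hK
  obtain ⟨R, hR⟩ := hK.isBounded.subset_closedBall 0
  obtain ⟨χ, hχ, hχc, hχ1⟩ := exists_contDiff_eq_one_on_closedBall N R
  obtain ⟨M, hM⟩ := hub _ hχc.isCompact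
  set δ : ℕ → ℝ := fun k => 1 / ((k : ℝ) + 1)
  have hmain := fun k => integral_tameCube_le hu hub hG hH hG2 hH2 huG hGH hχ hχc hM
    (by positivity : 0 < δ k)
    (by rw [div_le_one (by positivity)]; linarith [(Nat.cast_nonneg k : (0 : ℝ) ≤ k)])
  set D := 2 * ∫ x, (9 * M ^ 2 * (H x ^ 2 * χ x ^ 2) + 4 * M ^ 2 * (G x ^ 2 * pd N i χ x ^ 2))
  have hnn : ∀ k x, 0 ≤ tameCube (δ k) (G x) * G x * χ x ^ 2 := by
    intro k x
    have : tameCube (δ k) (G x) * G x * χ x ^ 2 = G x ^ 4 * χ x ^ 2 / (1 + δ k * G x ^ 4) := by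
      rw [tameCube]; ring
    rw [this]
    positivity
  have hlim : ∀ x, Tendsto (fun k => tameCube (δ k) (G x) * G x * χ x ^ 2) atTop
      (𝓝 (G x ^ 4 * χ x ^ 2)) := by
    intro x
    have h := tendsto_one_div_add_atTop_nhds_zero_nat (𝕜 := ℝ)
    have h2 := (tendsto_const_nhds (x := G x ^ 3)).div ((h.mul_const (G x ^ 4)).const_add 1)
      (by simp)
    have h3 := (h2.mul_const (G x)).mul_const (χ x ^ 2)
    simp only [zero_mul, add_zero, div_one, ← pow_succ] at h3
    exact h3
  have hint : Integrable fun x => G x ^ 4 * χ x ^ 2 := by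
    refine ⟨(hG.aestronglyMeasurable.pow 4).mul (hχ.continuous.pow 2).aestronglyMeasurable, ?_⟩
    rw [hasFiniteIntegral_iff_ofReal (ae_of_all _ fun x => by positivity)]
    calc ∫⁻ x, ENNReal.ofReal (G x ^ 4 * χ x ^ 2)
        = ∫⁻ x, liminf (fun k => ENNReal.ofReal (tameCube (δ k) (G x) * G x * χ x ^ 2)) atTop :=
          lintegral_congr fun x => ((ENNReal.tendsto_ofReal (hlim x)).liminf_eq).symm
      _ ≤ liminf (fun k => ∫⁻ x, ENNReal.ofReal (tameCube (δ k) (G x) * G x * χ x ^ 2)) atTop :=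
          lintegral_liminf_le' fun k => (hmain k).1.aestronglyMeasurable.aemeasurable.ennreal_ofReal
      _ ≤ ENNReal.ofReal D := by
          refine liminf_le_of_le (by isBoundedDefault) fun b hb => ?_
          obtain ⟨k, hk⟩ := hb.exists
          refine hk.trans ?_
          rw [← ofReal_integral_eq_lintegral_ofReal (hmain k).1 (ae_of_all _ (hnn k))]
          exact ENNReal.ofReal_le_ofReal (hmain k).2
      _ < _ := ENNReal.ofReal_lt_top
  refine hint.integrableOn.congr_fun (fun x hx => ?_) hK.measurableSet
  simp [hχ1 x (hR hx)]

end FourthPower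

section NonLocallyIntegrable

variable {N : ℕ} {i : Fin N} {v f : EuclideanSpace ℝ (Fin N) → ℝ}

lemma IsWeakPd.integral_eq_zero_of_not_locallyIntegrable (hv : LocallyIntegrable v)
    (h : IsWeakPd N i v f) (hf : ¬LocallyIntegrable f) {φ : EuclideanSpace ℝ (Fin N) → ℝ}
    (hφ : ContDiff ℝ ∞ φ) (hφc : HasCompactSupport φ) : ∫ x, f x * φ x = 0 := by
  rw [locallyIntegrable_iff] at hf
  push Not at hf
  obtain ⟨K, hK, hfK⟩ := hf
  obtain ⟨R, hR⟩ := hK.isBounded.subset_closedBall 0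
  obtain ⟨χ, hχ, hχc, hχ1⟩ := exists_contDiff_eq_one_on_closedBall N R
  have hfχ : ¬Integrable fun x => f x * χ x := fun hi => hfK <|
    hi.integrableOn.congr_fun (fun x hx => by simp [hχ1 x (hR hx)]) hK.measurableSet
  by_cases hfφ : Integrable fun x => f x * φ x
  · have hfs : ¬Integrable fun x => f x * (χ x + φ x) := fun hi => hfχ <|
      (hi.sub hfφ).congr (ae_of_all _ fun x => by simp [mul_add])
    have e₁ := h χ hχ hχc
    have e₂ := h φ hφ hφc
    have e₃ := h (fun x => χ x + φ x) (hχ.add hφ) (hχc.add hφc)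
    have hpd : ∀ x, pd N i (fun x => χ x + φ x) x = pd N i χ x + pd N i φ x := fun x => by
      simp only [pd]
      rw [fderiv_fun_add (hχ.differentiable (by simp) x) (hφ.differentiable (by simp) x)]
      simp
    have h1 := integrable_mul_test hv (contDiff_pd i hχ).continuous (hasCompactSupport_pd i hχc)
    have h2 := integrable_mul_test hv (contDiff_pd i hφ).continuous (hasCompactSupport_pd i hφc)
    rw [integral_undef hfχ] at e₁
    rw [integral_undef hfs] at e₃
    simp only [hpd, mul_add] at e₃
    rw [integral_add h1 h2] at e₃
    linarith
  · exact integral_undef hfφ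

open Classical in
/-- `f` if `f` is locally integrable, and `0` otherwise. -/
noncomputable def locPart (f : EuclideanSpace ℝ (Fin N) → ℝ) : EuclideanSpace ℝ (Fin N) → ℝ :=
  if LocallyIntegrable f then f else fun _ => 0

lemma locPart_of_locallyIntegrable (hf : LocallyIntegrable f) : locPart f = f := if_pos hf

lemma locPart_of_not (hf : ¬LocallyIntegrable f) : locPart f = fun _ => 0 := if_neg hf

lemma locallyIntegrable_locPart : LocallyIntegrable (locPart f) := by
  by_cases hf : LocallyIntegrable f
  · rwa [locPart_of_locallyIntegrable hf]
  · rw [locPart_of_not hf]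
    exact locallyIntegrable_const 0

lemma locallyIntegrable_locPart_sq (h : LocallyIntegrable fun x => f x ^ 2) :
    LocallyIntegrable fun x => locPart f x ^ 2 := by
  by_cases hf : LocallyIntegrable f
  · rwa [locPart_of_locallyIntegrable hf]
  · simpa [locPart_of_not hf] using locallyIntegrable_const (0 : ℝ)

lemma IsWeakPd.locPart_right (hv : LocallyIntegrable v) (h : IsWeakPd N i v f) :
    IsWeakPd N i v (locPart f) := by
  by_cases hf : LocallyIntegrable f
  · rwa [locPart_of_locallyIntegrable hf]
  · intro φ hφ hφc
    rw [h φ hφ hφc, h.integral_eq_zero_of_not_locallyIntegrable hv hf hφ hφc]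
    simp [locPart_of_not hf]

lemma IsWeakPd.locPart_left {j : Fin N} {g : EuclideanSpace ℝ (Fin N) → ℝ}
    (hv : LocallyIntegrable v) (hvg : IsWeakPd N i v g) (h : IsWeakPd N j g f) :
    IsWeakPd N j (locPart g) f := by
  by_cases hg : LocallyIntegrable g
  · rwa [locPart_of_locallyIntegrable hg]
  · intro φ hφ hφc
    rw [← h φ hφ hφc, hvg.integral_eq_zero_of_not_locallyIntegrable hv hg (contDiff_pd j hφ)
      (hasCompactSupport_pd j hφc)]
    simp [locPart_of_not hg]

lemma integral_mul_mul_test_eq_zero {w : EuclideanSpace ℝ (Fin N) → ℝ}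
    (hf2 : LocallyIntegrable fun x => f x ^ 2)
    (h : ∀ φ : EuclideanSpace ℝ (Fin N) → ℝ, ContDiff ℝ ∞ φ → HasCompactSupport φ →
      ∫ x, f x * φ x = 0)
    (hw : AEStronglyMeasurable w) (hw0 : ∀ᵐ x, 0 < w x) {φ : EuclideanSpace ℝ (Fin N) → ℝ}
    (hφ : ContDiff ℝ ∞ φ) (hφc : HasCompactSupport φ) : ∫ x, w x * f x * φ x = 0 := by
  by_cases hi : Integrable fun x => w x * f x * φ x
  · have hm : AEStronglyMeasurable fun x => f x * φ x := by
      have h1 := hw.aemeasurable.inv.mul hi.aestronglyMeasurable.aemeasurable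
      refine h1.aestronglyMeasurable.congr ?_
      filter_upwards [hw0] with x hx
      simp only [Pi.mul_apply, Pi.inv_apply]
      field_simp
    have hsq : Integrable fun x => (f x * φ x) ^ 2 := by
      simp only [mul_pow]
      exact integrable_mul_test hf2 (hφ.continuous.pow 2)
        (hφc.comp_left (g := fun a : ℝ => a ^ 2) (by simp))
    have hz := ae_eq_zero_of_integral_mul_test_eq_zero
      (locallyIntegrable_of_sq hm fun K _ => hsq.integrableOn) fun η hη hηc => by
        simpa only [mul_assoc] using h _ (hφ.mul hη) hηc.mul_left
    refine integral_eq_zero_of_ae ?_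
    filter_upwards [hz] with x hx
    rw [mul_assoc, hx, mul_zero, Pi.zero_apply]
  · exact integral_undef hi

end NonLocallyIntegrable

section Powers

variable {N : ℕ} {u : EuclideanSpace ℝ (Fin N) → ℝ}

lemma locallyIntegrable_of_sq_of_nonneg (hpos : ∀ᵐ x, 0 ≤ u x)
    (h : ∀ K, IsCompact K → IntegrableOn (fun x => u x ^ 2) K) : LocallyIntegrable u := by
  refine locallyIntegrable_of_sq ?_ h
  refine (Real.continuous_sqrt.comp_aestronglyMeasurable
    (locallyIntegrable_iff.2 h).aestronglyMeasurable).congr ?_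
  filter_upwards [hpos] with x hx using Real.sqrt_sq hx

lemma locallyIntegrable_mul_sq {f g : EuclideanSpace ℝ (Fin N) → ℝ}
    (hf : AEStronglyMeasurable f) (hg : AEStronglyMeasurable g)
    (hf4 : LocallyIntegrable fun x => f x ^ 4) (hg4 : LocallyIntegrable fun x => g x ^ 4) :
    LocallyIntegrable fun x => (f x * g x) ^ 2 := by
  refine (hf4.add hg4).mono ((hf.mul hg).pow 2) (ae_of_all _ fun x => ?_)
  rw [Pi.add_apply, Real.norm_of_nonneg (by positivity), Real.norm_of_nonneg (by positivity)]
  nlinarith [sq_nonneg (f x ^ 2 - g x ^ 2), sq_nonneg (f x ^ 2), sq_nonneg (g x ^ 2)]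

lemma locallyIntegrable_add_sq {f g : EuclideanSpace ℝ (Fin N) → ℝ}
    (hf : AEStronglyMeasurable f) (hg : AEStronglyMeasurable g)
    (hf2 : LocallyIntegrable fun x => f x ^ 2) (hg2 : LocallyIntegrable fun x => g x ^ 2) :
    LocallyIntegrable fun x => (f x + g x) ^ 2 := by
  refine ((hf2.add hg2).smul (2 : ℝ)).mono ((hf.add hg).pow 2) (ae_of_all _ fun x => ?_)
  rw [Pi.smul_apply, Pi.add_apply, smul_eq_mul, Real.norm_of_nonneg (by positivity),
    Real.norm_of_nonneg (by positivity)]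
  nlinarith [sq_nonneg (f x - g x)]

lemma locallyIntegrable_linftyLoc_mul_sq {b f : EuclideanSpace ℝ (Fin N) → ℝ}
    (hbm : AEStronglyMeasurable b) (hb : LinftyLoc N b) (hf2 : LocallyIntegrable fun x => f x ^ 2) :
    LocallyIntegrable fun x => (b x * f x) ^ 2 := by
  simp only [mul_pow]
  exact locallyIntegrable_linftyLoc_mul hf2 (hbm.pow 2) (hb.comp_continuous (continuous_pow 2))

lemma LinftyLoc.mono {b c : EuclideanSpace ℝ (Fin N) → ℝ} (hb : LinftyLoc N b) {A : ℝ}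
    (h : ∀ x, |c x| ≤ max |b x| A) : LinftyLoc N c := by
  intro K hK
  obtain ⟨C, hC⟩ := hb K hK
  exact ⟨max C A, by
    filter_upwards [hC] with x hx hxK using (h x).trans (max_le_max_right _ (hx hxK))⟩

lemma continuous_mul_rpow {c p : ℝ} (hp : 0 ≤ p) : Continuous fun a : ℝ => c * a ^ p :=
  continuous_const.mul (Real.continuous_rpow_const hp)

lemma hasDerivAt_mul_rpow {p : ℝ} (c : ℝ) (hp : 1 ≤ p) (a : ℝ) :
    HasDerivAt (fun a : ℝ => c * a ^ p) (c * p * a ^ (p - 1)) a := by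
  simpa [mul_assoc] using (Real.hasDerivAt_rpow_const (Or.inr hp)).const_mul c

end Powers

/-- **Appendix 5.1 (used in Theorem 3.1).** If `u ∈ W^{2,2}_loc(ℝ^N) ∩ L^∞_loc(ℝ^N)`
with `u ≥ 0` and `Δu ≥ 0` a.e., and `γ > 2`, then `u^γ ∈ W^{2,2}_loc(ℝ^N)`,
`u^γ ≥ 0` a.e., and `Δ(u^γ) ≥ 0` a.e. -/
theorem stmt_14
    (N : ℕ) (hN : 4 < N)
    (u : EuclideanSpace ℝ (Fin N) → ℝ)
    (g : EuclideanSpace ℝ (Fin N) → Fin N → ℝ)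
    (h : EuclideanSpace ℝ (Fin N) → Fin N → Fin N → ℝ)
    (hsob : W22loc N u g h) (hbdd : LinftyLoc N u)
    (hpos : ∀ᵐ x ∂(volume : Measure (EuclideanSpace ℝ (Fin N))), 0 ≤ u x)
    (hlap : ∀ᵐ x ∂(volume : Measure (EuclideanSpace ℝ (Fin N))), 0 ≤ wlap N h x)
    (γ : ℝ) (hγ : 2 < γ) :
    ∃ (gγ : EuclideanSpace ℝ (Fin N) → Fin N → ℝ)
      (hγ' : EuclideanSpace ℝ (Fin N) → Fin N → Fin N → ℝ),
      W22loc N (fun x => u x ^ γ) gγ hγ' ∧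
      (∀ᵐ x ∂(volume : Measure (EuclideanSpace ℝ (Fin N))), 0 ≤ u x ^ γ) ∧
      (∀ᵐ x ∂(volume : Measure (EuclideanSpace ℝ (Fin N))), 0 ≤ wlap N hγ' x) := by
  classical
  have hu := locallyIntegrable_of_sq_of_nonneg hpos hsob.u_sq
  have hg2 : ∀ i, LocallyIntegrable fun x => g x i ^ 2 := fun i =>
    locallyIntegrable_iff.2 (hsob.g_sq i)
  have hh2 : ∀ i j, LocallyIntegrable fun x => h x i j ^ 2 := fun i j =>
    locallyIntegrable_iff.2 (hsob.h_sq i j)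
  set G : Fin N → EuclideanSpace ℝ (Fin N) → ℝ := fun i => locPart fun x => g x i
  set H : Fin N → Fin N → EuclideanSpace ℝ (Fin N) → ℝ := fun i j => locPart fun x => h x i j
  have hG : ∀ i, LocallyIntegrable (G i) := fun i => locallyIntegrable_locPart
  have hH : ∀ i j, LocallyIntegrable (H i j) := fun i j => locallyIntegrable_locPart
  have hG2 : ∀ i, LocallyIntegrable fun x => G i x ^ 2 := fun i =>
    locallyIntegrable_locPart_sq (hg2 i)
  have hH2 : ∀ i j, LocallyIntegrable fun x => H i j x ^ 2 := fun i j =>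
    locallyIntegrable_locPart_sq (hh2 i j)
  have huG : ∀ i, IsWeakPd N i u (G i) := fun i => (hsob.grad_spec i).locPart_right hu
  have hGh : ∀ i j, IsWeakPd N j (G i) fun x => h x i j := fun i j =>
    (hsob.grad_spec i).locPart_left hu (hsob.hess_spec i j)
  have hGH : ∀ i j, IsWeakPd N j (G i) (H i j) := fun i j => (hGh i j).locPart_right (hG i)
  have hG4 : ∀ i, LocallyIntegrable fun x => G i x ^ 4 := fun i =>
    (huG i).locallyIntegrable_pow_four hu hbdd (hG i) (hH i i) (hG2 i) (hH2 i i) (hGH i i)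
  have hGG2 : ∀ i j, LocallyIntegrable fun x => (G i x * G j x) ^ 2 := fun i j =>
    locallyIntegrable_mul_sq (hG i).aestronglyMeasurable (hG j).aestronglyMeasurable (hG4 i) (hG4 j)
  have hGG : ∀ i j, LocallyIntegrable fun x => G i x * G j x := fun i j =>
    locallyIntegrable_of_sq ((hG i).aestronglyMeasurable.mul (hG j).aestronglyMeasurable)
      (locallyIntegrable_iff.1 (hGG2 i j))
  have hGzero : ∀ i, ¬LocallyIntegrable (fun x => h x i i) → ∀ᵐ x, G i x = 0 := by
    intro i hi
    refine (huG i).ae_eq_zero_of_nonneg_of_zero hu (hG i) hpos ?_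
    have := hGH i i
    simp only [H, locPart_of_not hi] at this
    exact this
  have hP0 : Continuous fun a : ℝ => a ^ γ := Real.continuous_rpow_const (by linarith)
  have hP1 : Continuous fun a : ℝ => γ * a ^ (γ - 1) := continuous_mul_rpow (by linarith)
  have hP2 : Continuous fun a : ℝ => γ * (γ - 1) * a ^ (γ - 1 - 1) :=
    continuous_mul_rpow (by linarith)
  have hum := hu.aestronglyMeasurable
  have hP1m := hP1.comp_aestronglyMeasurable hum
  have hP2m := hP2.comp_aestronglyMeasurable hum
  have hP1b := hbdd.comp_continuous hP1
  have hP2b := hbdd.comp_continuous hP2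
  set w : EuclideanSpace ℝ (Fin N) → ℝ := fun x => if u x = 0 then 1 else γ * u x ^ (γ - 1)
  have hwm : AEStronglyMeasurable w := by
    have hmeas : Measurable fun a : ℝ => if a = 0 then 1 else γ * a ^ (γ - 1) :=
      Measurable.ite (measurableSet_singleton 0) measurable_const hP1.measurable
    exact (hmeas.comp_aemeasurable hum.aemeasurable).aestronglyMeasurable
  have hwb : LinftyLoc N w := hP1b.mono (A := 1) fun x => by
    by_cases hx : u x = 0 <;> simp [w, hx]
  have hwpos : ∀ᵐ x, 0 < w x := by
    filter_upwards [hpos] with x hx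
    simp only [w]
    split_ifs with h0
    · exact one_pos
    · have := Real.rpow_pos_of_pos (lt_of_le_of_ne hx (Ne.symm h0)) (γ - 1)
      positivity
  set E : Fin N → Fin N → EuclideanSpace ℝ (Fin N) → ℝ := fun i j x =>
    γ * (γ - 1) * u x ^ (γ - 1 - 1) * (G i x * G j x) + γ * u x ^ (γ - 1) * H i j x
  have hE : ∀ i j, IsWeakPd N j (fun x => γ * u x ^ (γ - 1) * G i x) (E i j) := fun i j =>
    IsWeakPd.comp_mul hu hbdd (hG j) (hG i) (hH i j) (hGG i j) (huG j) (hGH i j)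
      (hasDerivAt_mul_rpow γ (by linarith)) hP2
  have hE2 : ∀ i j, LocallyIntegrable fun x => E i j x ^ 2 := fun i j =>
    locallyIntegrable_add_sq (hP2m.mul (hGG i j).aestronglyMeasurable)
      (hP1m.mul (hH i j).aestronglyMeasurable)
      (locallyIntegrable_linftyLoc_mul_sq hP2m hP2b (hGG2 i j))
      (locallyIntegrable_linftyLoc_mul_sq hP1m hP1b (hH2 i j))
  refine ⟨fun x i => γ * u x ^ (γ - 1) * G i x, fun x i j =>
    if i = j ∧ ¬LocallyIntegrable (fun x => h x i i) then w x * h x i i else E i j x,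
    ⟨fun i => ?_, fun i j => ?_, fun K hK => ?_, fun i => ?_, fun i j => ?_⟩, ?_, ?_⟩
  · refine IsWeakPd.comp (P := fun a => a ^ γ) hu hbdd (hG i) (huG i) (fun a => ?_) hP1
    exact Real.hasDerivAt_rpow_const (Or.inr (by linarith))
  · by_cases hij : i = j ∧ ¬LocallyIntegrable (fun x => h x i i)
    · simp only [if_pos hij]
      obtain ⟨rfl, hi⟩ := hij
      intro φ hφ hφc
      rw [integral_mul_mul_test_eq_zero (hh2 i i) (fun ψ hψ hψc =>
        (hGh i i).integral_eq_zero_of_not_locallyIntegrable (hG i) hi hψ hψc) hwm hwpos hφ hφc,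
        neg_zero]
      refine integral_eq_zero_of_ae ?_
      filter_upwards [hGzero i hi] with x hx
      simp [hx]
    · simp only [if_neg hij]
      exact hE i j
  · have := (locallyIntegrable_const (1 : ℝ) (μ := (volume : Measure (EuclideanSpace ℝ (Fin N)))))
    have h2 := locallyIntegrable_linftyLoc_mul_sq (hP0.comp_aestronglyMeasurable hum)
      (hbdd.comp_continuous hP0) (f := fun _ => 1) (by simpa using this)
    simpa only [mul_one] using h2.integrableOn_isCompact hK
  · exact locallyIntegrable_iff.1 (locallyIntegrable_linftyLoc_mul_sq hP1m hP1b (hG2 i))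
  · by_cases hij : i = j ∧ ¬LocallyIntegrable (fun x => h x i i)
    · simp only [if_pos hij]
      exact locallyIntegrable_iff.1 (locallyIntegrable_linftyLoc_mul_sq hwm hwb (hh2 i i))
    · simp only [if_neg hij]
      exact locallyIntegrable_iff.1 (hE2 i j)
  · filter_upwards [hpos] with x hx using Real.rpow_nonneg hx γ
  · have hGu : ∀ᵐ x, ∀ i, u x = 0 → G i x = 0 :=
      ae_all_iff.2 fun i => (huG i).ae_eq_zero_of_eq_zero hu (hG i)
    have hHG : ∀ᵐ x, ∀ i, G i x = 0 → H i i x = 0 :=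
      ae_all_iff.2 fun i => (hGH i i).ae_eq_zero_of_eq_zero (hG i) (hH i i)
    filter_upwards [hlap, hpos, hwpos, hGu, hHG] with x hx hux hwx hGux hHGx
    refine (mul_nonneg hwx.le hx).trans ?_
    rw [wlap, wlap, Finset.mul_sum]
    refine Finset.sum_le_sum fun i _ => ?_
    split_ifs with hi
    · exact le_rfl
    · have hi' : LocallyIntegrable fun x => h x i i := by simpa using hi
      have hHi : h x i i = H i i x := by simp only [H, locPart_of_locallyIntegrable hi']
      rw [hHi]
      by_cases h0 : u x = 0
      · simp [E, hHGx i (hGux i h0), hGux i h0]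
      · simp only [w, if_neg h0, E]
        have h1 := Real.rpow_nonneg hux (γ - 1 - 1)
        have h2 : 0 ≤ γ * (γ - 1) := mul_nonneg (by linarith) (by linarith)
        have h3 := mul_nonneg (mul_nonneg h2 h1) (mul_self_nonneg (G i x))
        linarith
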